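/- (Projection onto the condition-number-constrained set.) Let X be a real symmetric p×p matrix with spectral decomposition X = V diag(d₁, ..., d_p) Vᵀ, V orthogonal, d₁ ≥ ... ≥ d_p, and let κ ≥ 1. For u > 0 set λ*ᵢ(u) = max(u, min(dᵢ, κu)). Suppose u* > 0 minimizes u ↦ ∑ᵢ (λ*ᵢ(u) − dᵢ)² over (0,∞). Then Ω* = V diag(λ*₁(u*), ..., λ*_p(u*)) Vᵀ minimizes the Frobenius norm ‖Ω − X‖_F over all Ω ∈ C_κ; that is, Ω* is an orthogonal projection of X onto C_κ. -/

import Mathlib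

open Matrix

/-- The largest eigenvalue of a real symmetric matrix. -/
noncomputable def lamMax {p : ℕ} {Ω : Matrix (Fin p) (Fin p) ℝ} (hΩ : Ω.IsHermitian) : ℝ :=
  ⨆ i, hΩ.eigenvalues i

/-- The smallest eigenvalue of a real symmetric matrix. -/
noncomputable def lamMin {p : ℕ} {Ω : Matrix (Fin p) (Fin p) ℝ} (hΩ : Ω.IsHermitian) : ℝ :=
  ⨅ i, hΩ.eigenvalues i

/-- The Frobenius norm of a real square matrix, `‖A‖_F = √Tr(AᵀA)`. -/
noncomputable def frobNorm {p : ℕ} (A : Matrix (Fin p) (Fin p) ℝ) : ℝ :=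
  Real.sqrt (Aᵀ * A).trace

theorem mul_diagonal_mul_transpose_apply_mem_Icc {n : Type*} [Fintype n] [DecidableEq n]
    {Q : Matrix n n ℝ} (hQ : Q * Qᵀ = 1) {μ : n → ℝ} {a b : ℝ}
    (hμ : ∀ j, μ j ∈ Set.Icc a b) (i : n) :
    (Q * Matrix.diagonal μ * Qᵀ) i i ∈ Set.Icc a b := by
  have hsum : ∑ j, Q i j ^ 2 = 1 := by
    have h := congrFun (congrFun hQ i) i
    simpa [Matrix.mul_apply, sq] using h
  have hval : (Q * Matrix.diagonal μ * Qᵀ) i i = ∑ j, Q i j ^ 2 * μ j := by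
    rw [Matrix.mul_apply]
    refine Finset.sum_congr rfl fun j _ => ?_
    rw [Matrix.mul_diagonal, Matrix.transpose_apply]
    ring
  rw [hval]
  constructor
  · calc a = ∑ j, Q i j ^ 2 * a := by rw [← Finset.sum_mul, hsum, one_mul]
      _ ≤ _ := Finset.sum_le_sum fun j _ => mul_le_mul_of_nonneg_left (hμ j).1 (sq_nonneg _)
  · calc _ ≤ ∑ j, Q i j ^ 2 * b :=
          Finset.sum_le_sum fun j _ => mul_le_mul_of_nonneg_left (hμ j).2 (sq_nonneg _)
      _ = b := by rw [← Finset.sum_mul, hsum, one_mul]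

theorem exists_orthogonal_diagonalization {n : Type*} [Fintype n] [DecidableEq n]
    {A : Matrix n n ℝ} (hA : A.IsHermitian) :
    ∃ U : Matrix n n ℝ, Uᵀ * U = 1 ∧ U * Uᵀ = 1 ∧
      A = U * Matrix.diagonal hA.eigenvalues * Uᵀ := by
  have h1 : (hA.eigenvectorUnitary : Matrix n n ℝ)ᵀ * (hA.eigenvectorUnitary : Matrix n n ℝ) = 1 := by
    have h := Unitary.coe_star_mul_self hA.eigenvectorUnitary
    rwa [Matrix.star_eq_conjTranspose, Matrix.conjTranspose_eq_transpose_of_trivial] at h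
  refine ⟨hA.eigenvectorUnitary, h1, mul_eq_one_comm.mp h1, ?_⟩
  have h := hA.spectral_theorem
  rw [Unitary.conjStarAlgAut_apply, Matrix.star_eq_conjTranspose,
    Matrix.conjTranspose_eq_transpose_of_trivial] at h
  exact h

theorem eigenvalues_mem_Icc_of_eq_mul_diagonal_mul_transpose {n : Type*} [Fintype n]
    [DecidableEq n] {A V : Matrix n n ℝ} (hA : A.IsHermitian) (hV : Vᵀ * V = 1) {μ : n → ℝ}
    (hAV : A = V * Matrix.diagonal μ * Vᵀ) {a b : ℝ} (hμ : ∀ j, μ j ∈ Set.Icc a b) (i : n) :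
    hA.eigenvalues i ∈ Set.Icc a b := by
  obtain ⟨U, hU, -, hAU⟩ := exists_orthogonal_diagonalization hA
  have hQ : (Uᵀ * V) * (Uᵀ * V)ᵀ = 1 := by
    rw [Matrix.transpose_mul, Matrix.transpose_transpose, Matrix.mul_assoc, ← Matrix.mul_assoc V,
      mul_eq_one_comm.mp hV, Matrix.one_mul, hU]
  have h := mul_diagonal_mul_transpose_apply_mem_Icc hQ hμ i
  have hdiag : (Uᵀ * V) * Matrix.diagonal μ * (Uᵀ * V)ᵀ = Matrix.diagonal hA.eigenvalues := by
    calc (Uᵀ * V) * Matrix.diagonal μ * (Uᵀ * V)ᵀ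
        = Uᵀ * (V * Matrix.diagonal μ * Vᵀ) * U := by
          simp only [Matrix.transpose_mul, Matrix.transpose_transpose, Matrix.mul_assoc]
      _ = (Uᵀ * U) * Matrix.diagonal hA.eigenvalues * (Uᵀ * U) := by
          rw [← hAV]
          conv_lhs => rw [hAU]
          simp only [Matrix.mul_assoc]
      _ = _ := by rw [hU, Matrix.one_mul, Matrix.mul_one]
  rwa [hdiag, Matrix.diagonal_apply_eq] at h

theorem frobNorm_eq_sqrt_sum_sq {p : ℕ} (A : Matrix (Fin p) (Fin p) ℝ) :
    frobNorm A = Real.sqrt (∑ j, ∑ i, A i j ^ 2) := by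
  simp [frobNorm, Matrix.trace, Matrix.mul_apply, sq]

theorem frobNorm_orthogonal_conj {p : ℕ} {V : Matrix (Fin p) (Fin p) ℝ} (hV : Vᵀ * V = 1)
    (M : Matrix (Fin p) (Fin p) ℝ) : frobNorm (V * M * Vᵀ) = frobNorm M := by
  have h : (V * M * Vᵀ)ᵀ * (V * M * Vᵀ) = V * (Mᵀ * M) * Vᵀ := by
    calc (V * M * Vᵀ)ᵀ * (V * M * Vᵀ) = V * Mᵀ * (Vᵀ * V) * M * Vᵀ := by
          simp only [Matrix.transpose_mul, Matrix.transpose_transpose, Matrix.mul_assoc]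
      _ = _ := by rw [hV, Matrix.mul_one, Matrix.mul_assoc V]
  rw [frobNorm, frobNorm, h, Matrix.trace_mul_comm, ← Matrix.mul_assoc, hV, Matrix.one_mul]

theorem frobNorm_diagonal {p : ℕ} (μ : Fin p → ℝ) :
    frobNorm (Matrix.diagonal μ) = Real.sqrt (∑ i, μ i ^ 2) := by
  simp [frobNorm, Matrix.trace, sq]

theorem sqrt_sum_diag_sq_le_frobNorm {p : ℕ} (A : Matrix (Fin p) (Fin p) ℝ) :
    Real.sqrt (∑ i, A i i ^ 2) ≤ frobNorm A := by
  rw [frobNorm_eq_sqrt_sum_sq]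
  exact Real.sqrt_le_sqrt <| Finset.sum_le_sum fun j _ =>
    Finset.single_le_sum (f := fun i => A i j ^ 2) (fun i _ => sq_nonneg _) (Finset.mem_univ j)

theorem sq_clip_sub_le {a b x w : ℝ} (hw : w ∈ Set.Icc a b) :
    (max a (min x b) - x) ^ 2 ≤ (w - x) ^ 2 := by
  obtain ⟨h1, h2⟩ := hw
  rcases le_total x b with hxb | hxb
  · rw [min_eq_left hxb]
    rcases le_total a x with hax | hax
    · rw [max_eq_right hax]
      nlinarith [sq_nonneg (w - x)]
    · rw [max_eq_left hax]
      nlinarith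
  · rw [min_eq_right hxb, max_eq_right (h1.trans h2)]
    nlinarith


/-- projection onto the condition-number-constrained set: with
`X = V diag(d) Vᵀ` (`V` orthogonal, `d` decreasing), `κ ≥ 1`,
`λ*ᵢ(u) = max(u, min(dᵢ, κu))`, and `u* > 0` a global minimizer of
`u ↦ ∑ᵢ (λ*ᵢ(u) − dᵢ)²` over `(0,∞)`, the matrix `Ω* = V diag(λ*(u*)) Vᵀ`
minimizes `‖Ω − X‖_F` over `C_κ`. -/
theorem stmt11 {p : ℕ} (X V : Matrix (Fin p) (Fin p) ℝ) (d : Fin p → ℝ) (hd : Antitone d)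
    (hV : Vᵀ * V = 1) (hX : X = V * Matrix.diagonal d * Vᵀ)
    (κ : ℝ) (hκ : 1 ≤ κ)
    (ustar : ℝ) (hustar : 0 < ustar)
    (hustarmin : ∀ u ∈ Set.Ioi (0 : ℝ),
      (∑ i, (max ustar (min (d i) (κ * ustar)) - d i) ^ 2) ≤
        ∑ i, (max u (min (d i) (κ * u)) - d i) ^ 2) :
    (∃ hstar : (V * Matrix.diagonal (fun i => max ustar (min (d i) (κ * ustar))) * Vᵀ).PosDef,
        lamMax hstar.1 ≤ κ * lamMin hstar.1) ∧
      ∀ (Ω : Matrix (Fin p) (Fin p) ℝ) (hΩ : Ω.PosDef),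
        lamMax hΩ.1 ≤ κ * lamMin hΩ.1 →
        frobNorm ((V * Matrix.diagonal (fun i => max ustar (min (d i) (κ * ustar))) * Vᵀ) - X) ≤
          frobNorm (Ω - X) := by
  have hclip : ∀ i, max ustar (min (d i) (κ * ustar)) ∈ Set.Icc ustar (κ * ustar) := fun i =>
    ⟨le_max_left _ _, max_le (le_mul_of_one_le_left hustar.le hκ) (min_le_right _ _)⟩
  rcases isEmpty_or_nonempty (Fin p) with hp | hp
  · refine ⟨⟨⟨Subsingleton.elim _ _, fun x hx => (hx (Subsingleton.elim _ _)).elim⟩, ?_⟩,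
      fun Ω _ _ => ?_⟩
    · simp [lamMax, lamMin]
    · simp [frobNorm_eq_sqrt_sum_sq]
  refine ⟨?_, fun Ω hΩ hcond => ?_⟩
  · have hH : (V * Matrix.diagonal (fun i => max ustar (min (d i) (κ * ustar))) * Vᵀ).IsHermitian := by
      rw [Matrix.IsHermitian, Matrix.conjTranspose_eq_transpose_of_trivial]
      simp [Matrix.transpose_mul, Matrix.mul_assoc]
    have hev := eigenvalues_mem_Icc_of_eq_mul_diagonal_mul_transpose hH hV rfl hclip
    refine ⟨hH.posDef_iff_eigenvalues_pos.mpr fun i => hustar.trans_le (hev i).1, ?_⟩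
    calc lamMax _ ≤ κ * ustar := ciSup_le fun i => (hev i).2
      _ ≤ κ * lamMin _ :=
          mul_le_mul_of_nonneg_left (le_ciInf fun i => (hev i).1) (zero_le_one.trans hκ)
  · have hu : 0 < lamMin hΩ.1 := by
      obtain ⟨i, hi⟩ := exists_eq_ciInf_of_finite (f := hΩ.1.eigenvalues)
      rw [lamMin, ← hi]
      exact hΩ.eigenvalues_pos i
    have hev : ∀ i, hΩ.1.eigenvalues i ∈ Set.Icc (lamMin hΩ.1) (κ * lamMin hΩ.1) := fun i =>
      ⟨ciInf_le (Set.finite_range _).bddBelow i,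
        (le_ciSup (Set.finite_range hΩ.1.eigenvalues).bddAbove i).trans hcond⟩
    have hV' : V * Vᵀ = 1 := mul_eq_one_comm.mp hV
    obtain ⟨U, -, hU, hΩU⟩ := exists_orthogonal_diagonalization hΩ.1
    have hW : ∀ i, (Vᵀ * Ω * V) i i ∈ Set.Icc (lamMin hΩ.1) (κ * lamMin hΩ.1) := by
      have hQ : (Vᵀ * U) * (Vᵀ * U)ᵀ = 1 := by
        rw [Matrix.transpose_mul, Matrix.transpose_transpose, Matrix.mul_assoc,
          ← Matrix.mul_assoc U, hU, Matrix.one_mul, hV]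
      have hconj : Vᵀ * Ω * V =
          (Vᵀ * U) * Matrix.diagonal hΩ.1.eigenvalues * (Vᵀ * U)ᵀ := by
        conv_lhs => rw [hΩU]
        simp only [Matrix.transpose_mul, Matrix.transpose_transpose, Matrix.mul_assoc]
      rw [hconj]
      exact mul_diagonal_mul_transpose_apply_mem_Icc hQ hev
    have hleft : V * Matrix.diagonal (fun i => max ustar (min (d i) (κ * ustar))) * Vᵀ - X =
        V * Matrix.diagonal (fun i => max ustar (min (d i) (κ * ustar)) - d i) * Vᵀ := by
      rw [hX, ← Matrix.diagonal_sub, Matrix.mul_sub, Matrix.sub_mul]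
    have hright : Ω - X = V * (Vᵀ * Ω * V - Matrix.diagonal d) * Vᵀ := by
      have hback : V * (Vᵀ * Ω * V) * Vᵀ = Ω := by
        calc V * (Vᵀ * Ω * V) * Vᵀ = (V * Vᵀ) * Ω * (V * Vᵀ) := by
              simp only [Matrix.mul_assoc]
          _ = Ω := by rw [hV', Matrix.one_mul, Matrix.mul_one]
      rw [Matrix.mul_sub, Matrix.sub_mul, hback, hX]
    rw [hleft, hright, frobNorm_orthogonal_conj hV, frobNorm_orthogonal_conj hV,
      frobNorm_diagonal]
    refine le_trans (Real.sqrt_le_sqrt ((hustarmin _ hu).trans ?_))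
      (sqrt_sum_diag_sq_le_frobNorm _)
    refine Finset.sum_le_sum fun i _ => ?_
    rw [Matrix.sub_apply, Matrix.diagonal_apply_eq]
    exact sq_clip_sub_le (hW i)
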